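/- Let 0 < b ≤ c < 1, set κ := (−b·log(1−c) + c·log(1−b))/c, and let R > κ with δ := R − κ. Let X be uniformly distributed on a set of size 2^{⌈Rn⌉}, let L_1,…,L_n be {0,1}-valued and T=(T_1,…,T_m) a message sequence with speaker assignment j as above, satisfying: for each round k, conditioned on the previous messages and L_{j(k)}=0 the message T_k is independent of X; Pr(L_i=1 | X=x) = b for all i,x; and Pr(L_i=1 | T=t, X=x) ≤ c for all i and all (t,x) of positive probability. Then for every function D from transcripts to the range of X, the error probability satisfies Pr(D(T) ≠ X) ≥ (δ·n − 1)/⌈Rn⌉. -/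

import Mathlib

open Finset

/-- Probability of an event `E` under the probability mass function `p`
on a finite sample space `Ω`. -/
noncomputable def Pr {Ω : Type*} [Fintype Ω] (p : Ω → ℝ) (E : Set Ω) : ℝ :=
  ∑ ω, E.indicator p ω

/-- Conditional probability `Pr(E | F)`. -/
noncomputable def cPr {Ω : Type*} [Fintype Ω] (p : Ω → ℝ) (E F : Set Ω) : ℝ :=
  Pr p (E ∩ F) / Pr p F

/-- The suspicion given a random variable `Yv`:
`susp(Y) = Σ_y Pr(Y=y) · (−log₂ Pr(L=0 | Y=y))`. -/
noncomputable def susp {Ω Y : Type*} [Fintype Ω] [Fintype Y] (p : Ω → ℝ)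
    (L : Ω → Bool) (Yv : Ω → Y) : ℝ :=
  ∑ y, Pr p {ω | Yv ω = y} * (-Real.logb 2 (cPr p {ω | L ω = false} {ω | Yv ω = y}))

/-- Mutual information (base 2) between two finite-valued random variables. -/
noncomputable def mutInfo {Ω S T : Type*} [Fintype Ω] [Fintype S] [Fintype T]
    (p : Ω → ℝ) (Xv : Ω → S) (Av : Ω → T) : ℝ :=
  ∑ x, ∑ a, Pr p {ω | Xv ω = x ∧ Av ω = a} *
    Real.logb 2 (Pr p {ω | Xv ω = x ∧ Av ω = a} /
      (Pr p {ω | Xv ω = x} * Pr p {ω | Av ω = a}))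

/-- Conditional Shannon entropy (base 2) `H(A | X)`. -/
noncomputable def condEntropy {Ω S T : Type*} [Fintype Ω] [Fintype S] [Fintype T]
    (p : Ω → ℝ) (Av : Ω → T) (Xv : Ω → S) : ℝ :=
  ∑ x, ∑ a, Pr p {ω | Xv ω = x ∧ Av ω = a} *
    Real.logb 2 (Pr p {ω | Xv ω = x} / Pr p {ω | Xv ω = x ∧ Av ω = a})

/-- Conditional mutual information (base 2) `I(X; A | Z)`. -/
noncomputable def condMutInfo {Ω S T U : Type*} [Fintype Ω] [Fintype S] [Fintype T] [Fintype U]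
    (p : Ω → ℝ) (Xv : Ω → S) (Av : Ω → T) (Zv : Ω → U) : ℝ :=
  ∑ z, ∑ x, ∑ a, Pr p {ω | Xv ω = x ∧ Av ω = a ∧ Zv ω = z} *
    Real.logb 2 ((Pr p {ω | Xv ω = x ∧ Av ω = a ∧ Zv ω = z} * Pr p {ω | Zv ω = z}) /
      (Pr p {ω | Xv ω = x ∧ Zv ω = z} * Pr p {ω | Av ω = a ∧ Zv ω = z}))

open Classical in
noncomputable def mass {Ω α : Type*} [Fintype Ω] (w : Ω → ℝ) (Y : Ω → α) (ω : Ω) : ℝ :=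
  ∑ ω', if Y ω' = Y ω then w ω' else 0

lemma mass_nonneg {Ω α : Type*} [Fintype Ω] {w : Ω → ℝ} (hw : ∀ ω, 0 ≤ w ω) (Y : Ω → α) (ω : Ω) :
    0 ≤ mass w Y ω := by
  unfold mass
  exact Finset.sum_nonneg fun i _ => by split_ifs <;> simp [hw]

lemma le_mass {Ω α : Type*} [Fintype Ω] {w : Ω → ℝ} (hw : ∀ ω, 0 ≤ w ω) (Y : Ω → α) (ω : Ω) :
    w ω ≤ mass w Y ω := by
  classical
  unfold mass
  have := Finset.single_le_sum (f := fun ω' => if Y ω' = Y ω then w ω' else 0)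
    (fun i _ => by split_ifs <;> simp [hw]) (Finset.mem_univ ω)
  simpa using this

lemma mass_mono {Ω α β : Type*} [Fintype Ω] {w : Ω → ℝ} (hw : ∀ ω, 0 ≤ w ω) (Y' : Ω → α)
    (Y : Ω → β) (h : ∀ ω ω', Y' ω = Y' ω' → Y ω = Y ω') (ω : Ω) :
    mass w Y' ω ≤ mass w Y ω := by
  unfold mass
  apply Finset.sum_le_sum
  intro i _
  by_cases h1 : Y' i = Y' ω
  · simp [h1, h _ _ h1]
  · simp only [h1, if_false]
    split_ifs <;> simp [hw]

lemma mass_congr {Ω α : Type*} [Fintype Ω] (w : Ω → ℝ) (Y : Ω → α) {ω ω' : Ω}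
    (h : Y ω = Y ω') : mass w Y ω = mass w Y ω' := by
  unfold mass; rw [h]

lemma mass_swap {Ω α : Type*} [Fintype Ω] (w v h : Ω → ℝ) (hw : ∀ ω, 0 ≤ w ω)
    (hv : ∀ ω, 0 ≤ v ω) (hh : ∀ ω, 0 ≤ h ω) (Y : Ω → α)
    (hY : ∀ ω ω', Y ω = Y ω' → h ω = h ω') :
    ∑ ω, w ω * (mass v Y ω / mass w Y ω) * h ω ≤ ∑ ω, v ω * h ω := by
  classical
  calc ∑ ω, w ω * (mass v Y ω / mass w Y ω) * h ω
      = ∑ ω, ∑ ω', (if Y ω' = Y ω then v ω' * h ω' * (w ω / mass w Y ω') else 0) := by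
        refine Finset.sum_congr rfl fun ω _ => ?_
        have : mass v Y ω = ∑ ω', if Y ω' = Y ω then v ω' else 0 := by
          unfold mass; congr!
        rw [this, Finset.sum_div, Finset.mul_sum, Finset.sum_mul]
        refine Finset.sum_congr rfl fun ω' _ => ?_
        split_ifs with h1
        · rw [hY _ _ h1, mass_congr w Y h1]; ring
        · simp
    _ = ∑ ω', v ω' * h ω' * (mass w Y ω' / mass w Y ω') := by
        rw [Finset.sum_comm]
        refine Finset.sum_congr rfl fun ω' _ => ?_
        have : mass w Y ω' / mass w Y ω' = (∑ ω, if Y ω = Y ω' then w ω else 0) / mass w Y ω' := by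
          conv_lhs => arg 1; unfold mass
        rw [this, Finset.sum_div, Finset.mul_sum]
        refine Finset.sum_congr rfl fun ω _ => ?_
        by_cases h1 : Y ω' = Y ω
        · simp [h1]
        · simp [h1, Ne.symm h1]
    _ ≤ _ := by
        refine Finset.sum_le_sum fun ω _ => ?_
        exact mul_le_of_le_one_right (mul_nonneg (hv _) (hh _)) (div_self_le_one _)

lemma gibbs {Ω : Type*} [Fintype Ω] (p r : Ω → ℝ) (hp : ∀ ω, 0 ≤ p ω)
    (hr : ∀ ω, 0 < p ω → 0 < r ω) (h : ∑ ω, p ω * r ω ≤ ∑ ω, p ω) :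
    ∑ ω, p ω * Real.log (r ω) ≤ 0 := by
  calc ∑ ω, p ω * Real.log (r ω) ≤ ∑ ω, (p ω * r ω - p ω) := by
        refine Finset.sum_le_sum fun ω _ => ?_
        rcases (hp ω).eq_or_lt with h0 | h0
        · simp [← h0]
        · have := Real.log_le_sub_one_of_pos (hr ω h0)
          nlinarith
    _ ≤ 0 := by rw [Finset.sum_sub_distrib]; linarith

lemma mono_info {Ω α β : Type*} [Fintype Ω] (p v : Ω → ℝ) (hp : ∀ ω, 0 ≤ p ω)
    (hv : ∀ ω, 0 ≤ v ω) (Y' : Ω → α) (Y : Ω → β)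
    (h : ∀ ω ω', Y' ω = Y' ω' → Y ω = Y ω')
    (hpos : ∀ ω, 0 < p ω → 0 < mass v Y' ω) :
    ∑ ω, p ω * (Real.log (mass v Y' ω) - Real.log (mass v Y ω)) ≤
      ∑ ω, p ω * (Real.log (mass p Y' ω) - Real.log (mass p Y ω)) := by
  have hP' : ∀ ω, 0 < p ω → 0 < mass p Y' ω := fun ω h0 => h0.trans_le (le_mass hp _ _)
  have hP : ∀ ω, 0 < p ω → 0 < mass p Y ω := fun ω h0 => h0.trans_le (le_mass hp _ _)
  have hV : ∀ ω, 0 < p ω → 0 < mass v Y ω := fun ω h0 =>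
    (hpos ω h0).trans_le (mass_mono hv _ _ h _)
  have key := gibbs p (fun ω => (mass v Y' ω / mass p Y' ω) * (mass p Y ω / mass v Y ω)) hp
    (fun ω h0 => by have := hpos ω h0; have := hP' ω h0; have := hP ω h0; have := hV ω h0; positivity)
    (by
      have h1 := mass_swap p v (fun ω => mass p Y ω / mass v Y ω) hp hv
        (fun ω => div_nonneg (mass_nonneg hp _ _) (mass_nonneg hv _ _)) Y'
        (fun ω ω' e => by rw [mass_congr p Y (h _ _ e), mass_congr v Y (h _ _ e)])
      have h2 := mass_swap v p (fun _ => 1) hv hp (fun ω => zero_le_one) Y (fun _ _ _ => rfl)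
      simp only [mul_one] at h2
      simp only [← mul_assoc] 
      simp only [mul_assoc] at h1 ⊢
      linarith)
  rw [← sub_nonpos, ← Finset.sum_sub_distrib]
  refine le_trans (le_of_eq ?_) key
  refine Finset.sum_congr rfl fun ω _ => ?_
  rcases (hp ω).eq_or_lt with h0 | h0
  · simp [← h0]
  · have a := hpos ω h0; have b := hP' ω h0; have c := hP ω h0; have d := hV ω h0
    rw [Real.log_mul (by positivity) (by positivity), Real.log_div a.ne' b.ne',
      Real.log_div c.ne' d.ne']
    ring

lemma fano {Ω S β : Type*} [Fintype Ω] [Fintype S] [DecidableEq S] (p : Ω → ℝ)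
    (hp : ∀ ω, 0 ≤ p ω) (X : Ω → S) (Z : Ω → β) (g : Ω → ℝ) (G : S → β → ℝ)
    (hg : ∀ ω, g ω = G (X ω) (Z ω)) (hG : ∀ x z, 0 < G x z) (hG1 : ∀ z, ∑ x, G x z ≤ 1) :
    ∑ ω, p ω * Real.log (g ω) ≤
      ∑ ω, p ω * (Real.log (mass p (fun ω => (X ω, Z ω)) ω) - Real.log (mass p Z ω)) := by
  classical
  set Y : Ω → S × β := fun ω => (X ω, Z ω) with hYdef
  have hP' : ∀ ω, 0 < p ω → 0 < mass p Y ω := fun ω h0 => h0.trans_le (le_mass hp _ _)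
  have hP : ∀ ω, 0 < p ω → 0 < mass p Z ω := fun ω h0 => h0.trans_le (le_mass hp _ _)
  have key := gibbs p (fun ω => mass p Z ω * (g ω / mass p Y ω)) hp
    (fun ω h0 => by
      have := hP' ω h0; have := hP ω h0; have := hG (X ω) (Z ω); rw [← hg] at this; positivity)
    (by
      calc ∑ ω, p ω * (mass p Z ω * (g ω / mass p Y ω))
          = ∑ ω, ∑ ω', (if Z ω' = Z ω then p ω' * (p ω * (g ω / mass p Y ω)) else 0) := by
            refine Finset.sum_congr rfl fun ω _ => ?_
            have : mass p Z ω = ∑ ω', if Z ω' = Z ω then p ω' else 0 := by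
              unfold mass; congr!
            rw [this, Finset.sum_mul, Finset.mul_sum]
            refine Finset.sum_congr rfl fun ω' _ => ?_
            split_ifs <;> ring
        _ = ∑ ω', p ω' * ∑ x, ∑ ω, (if X ω = x then
              (if Z ω' = Z ω then (p ω * (g ω / mass p Y ω)) else 0) else 0) := by
            rw [Finset.sum_comm]
            refine Finset.sum_congr rfl fun ω' _ => ?_
            rw [Finset.sum_comm (γ := S), Finset.mul_sum]
            refine Finset.sum_congr rfl fun ω _ => ?_
            simp
        _ ≤ ∑ ω', p ω' * ∑ x, G x (Z ω') := by
            refine Finset.sum_le_sum fun ω' _ => mul_le_mul_of_nonneg_left ?_ (hp _)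
            refine Finset.sum_le_sum fun x _ => ?_
            by_cases hx : ∃ ω0, Y ω0 = (x, Z ω')
            · obtain ⟨ω0, h0⟩ := hx
              have h0' := h0
              simp only [hYdef, Prod.mk.injEq] at h0'
              have e : ∀ ω, (if X ω = x then
                  (if Z ω' = Z ω then (p ω * (g ω / mass p Y ω)) else 0) else 0)
                  = (if Y ω = Y ω0 then p ω else 0) * (G x (Z ω') / mass p Y ω0) := by
                intro ω
                by_cases h1 : X ω = x
                · by_cases h2 : Z ω' = Z ω
                  · have : Y ω = Y ω0 := by rw [h0]; simp [hYdef, h1, h2]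
                    rw [mass_congr p Y this, hg, h1, ← h2]
                    simp [this, h1]
                  · have : Y ω ≠ Y ω0 := by rw [h0]; simp [hYdef, h1, Ne.symm h2]
                    simp [h2, this]
                · have : Y ω ≠ Y ω0 := by rw [h0]; simp [hYdef, h1]
                  simp [h1, this]
              simp only [e]
              rw [← Finset.sum_mul]
              have : mass p Y ω0 = ∑ ω, if Y ω = Y ω0 then p ω else 0 := by
                unfold mass; congr!
              rw [← this, mul_div_assoc', mul_comm, mul_div_assoc]
              exact mul_le_of_le_one_right (hG _ _).le (div_self_le_one _)
            · refine le_trans (le_of_eq ?_) (hG x (Z ω')).le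
              refine Finset.sum_eq_zero fun ω _ => ?_
              split_ifs with h1 h2
              · exact (hx ⟨ω, by simp [hYdef, h1, h2]⟩).elim
              · rfl
              · rfl
        _ ≤ ∑ ω', p ω' := by
            refine Finset.sum_le_sum fun ω' _ => ?_
            exact mul_le_of_le_one_right (hp _) (hG1 _))
  rw [← sub_nonpos, ← Finset.sum_sub_distrib]
  refine le_trans (le_of_eq ?_) key
  refine Finset.sum_congr rfl fun ω _ => ?_
  rcases (hp ω).eq_or_lt with h0 | h0
  · simp [← h0]
  · have a := hP' ω h0; have b := hP ω h0; have d := hG (X ω) (Z ω); rw [← hg] at d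
    rw [Real.log_mul (by positivity) (by positivity), Real.log_div d.ne' a.ne']
    ring

/-- prefix of length `k` of the transcript -/
noncomputable def pre {Ω M : Type*} {m : ℕ} (T : Fin m → Ω → M) (k : ℕ) (ω : Ω) : Fin m → Option M :=
  fun i => if i.val < k then some (T i ω) else none

lemma pre_eq {Ω M : Type*} {m : ℕ} (T : Fin m → Ω → M) (k : ℕ) (ω ω' : Ω) :
    pre T k ω = pre T k ω' ↔ ∀ i : Fin m, i.val < k → T i ω = T i ω' := by
  unfold pre
  rw [funext_iff]
  refine forall_congr' fun i => ?_
  by_cases h : i.val < k <;> simp [h]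

open Classical in
/-- restriction of `p` to an event -/
noncomputable def res {Ω : Type*} (p : Ω → ℝ) (E : Set Ω) (ω : Ω) : ℝ := if ω ∈ E then p ω else 0

lemma res_nonneg {Ω : Type*} {p : Ω → ℝ} (hp : ∀ ω, 0 ≤ p ω) (E : Set Ω) (ω : Ω) :
    0 ≤ res p E ω := by
  unfold res; split_ifs <;> simp [hp]

lemma Pr_eq_mass {Ω α : Type*} [Fintype Ω] (p : Ω → ℝ) (E F : Set Ω) (Y : Ω → α) (ω : Ω)
    (h : ∀ ω', ω' ∈ F ↔ Y ω' = Y ω ∧ ω' ∈ E) : Pr p F = mass (res p E) Y ω := by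
  classical
  unfold Pr mass res
  refine Finset.sum_congr rfl fun ω' _ => ?_
  by_cases h1 : Y ω' = Y ω <;> by_cases h2 : ω' ∈ E <;> simp [Set.indicator, h, h1, h2]

lemma Pr_eq_mass' {Ω α : Type*} [Fintype Ω] (p : Ω → ℝ) (F : Set Ω) (Y : Ω → α) (ω : Ω)
    (h : ∀ ω', ω' ∈ F ↔ Y ω' = Y ω) : Pr p F = mass p Y ω := by
  classical
  unfold Pr mass
  refine Finset.sum_congr rfl fun ω' _ => ?_
  by_cases h1 : Y ω' = Y ω <;> simp [Set.indicator, h, h1]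

lemma mass_split {Ω α : Type*} [Fintype Ω] (p : Ω → ℝ) (L : Ω → Bool) (Y : Ω → α) (ω : Ω) :
    mass (res p {ω | L ω = true}) Y ω + mass (res p {ω | L ω = false}) Y ω = mass p Y ω := by
  unfold mass res
  rw [← Finset.sum_add_distrib]
  refine Finset.sum_congr rfl fun ω' _ => ?_
  by_cases h1 : Y ω' = Y ω <;> cases h : L ω' <;> simp [h1, h]

lemma neg_log_le (c u : ℝ) (hc0 : 0 < c) (hc1 : c < 1) (hu : 1 - c ≤ u) (hu1 : u ≤ 1) :
    -Real.log u ≤ (1 - u) * (-Real.log (1 - c) / c) := by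
  have hcc := strictConcaveOn_log_Ioi.concaveOn
  have := hcc.2 (show (1 - c) ∈ Set.Ioi (0:ℝ) by simp; linarith) (show (1:ℝ) ∈ Set.Ioi (0:ℝ) by simp)
    (show 0 ≤ (1 - u) / c from div_nonneg (by linarith) hc0.le)
    (show 0 ≤ 1 - (1 - u) / c by rw [sub_nonneg, div_le_one hc0]; linarith) (by ring)
  have e : ((1 - u) / c) • (1 - c) + (1 - (1 - u) / c) • (1:ℝ) = u := by
    simp only [smul_eq_mul]; field_simp; ring
  rw [e] at this
  simp only [smul_eq_mul, Real.log_one, mul_zero, add_zero] at this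
  have e2 : (1 - u) * (-Real.log (1 - c) / c) = - ((1 - u) / c * Real.log (1 - c)) := by ring
  rw [e2]; linarith

/-- with `X` uniform on a set of size `2^⌈Rn⌉` and rate
`R > κ := (−b·log₂(1−c)+c·log₂(1−b))/c`, any decoding function `D` errs
with probability at least `(δ·n − 1)/⌈Rn⌉`, where `δ = R − κ`. -/
theorem decoding_error_lower_bound {Ω S M : Type*} [Fintype Ω] [Fintype S] [Fintype M]
    {n m : ℕ}
    (p : Ω → ℝ) (hp : ∀ ω, 0 ≤ p ω) (hp1 : ∑ ω, p ω = 1)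
    (X : Ω → S) (L : Fin n → Ω → Bool) (T : Fin m → Ω → M) (j : Fin m → Fin n)
    (b c κ R δ : ℝ) (hb : 0 < b) (hbc : b ≤ c) (hc1 : c < 1)
    (hκ : κ = (-b * Real.logb 2 (1 - c) + c * Real.logb 2 (1 - b)) / c)
    (hR : κ < R) (hδ : δ = R - κ)
    (hcard : Fintype.card S = 2 ^ ⌈R * (n : ℝ)⌉₊)
    (hXunif : ∀ x : S, Pr p {ω | X ω = x} = ((2 : ℝ) ^ ⌈R * (n : ℝ)⌉₊)⁻¹)
    (hindep : ∀ (k : Fin m) (x : S) (a : M) (t : Fin m → M),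
      0 < Pr p {ω | X ω = x ∧ (∀ i, i < k → T i ω = t i) ∧ L (j k) ω = false} →
      cPr p {ω | T k ω = a}
          {ω | X ω = x ∧ (∀ i, i < k → T i ω = t i) ∧ L (j k) ω = false} =
        cPr p {ω | T k ω = a}
          {ω | (∀ i, i < k → T i ω = t i) ∧ L (j k) ω = false})
    (hprior : ∀ (i : Fin n) (x : S), 0 < Pr p {ω | X ω = x} →
      cPr p {ω | L i ω = true} {ω | X ω = x} = b)
    (hpost : ∀ (i : Fin n) (t : Fin m → M) (x : S),
      0 < Pr p {ω | (∀ k, T k ω = t k) ∧ X ω = x} →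
      cPr p {ω | L i ω = true} {ω | (∀ k, T k ω = t k) ∧ X ω = x} ≤ c) :
    ∀ D : (Fin m → M) → S,
      (δ * n - 1) / (⌈R * (n : ℝ)⌉₊ : ℝ) ≤
        Pr p {ω | D (fun k => T k ω) ≠ X ω} := by
  classical
  intro D
  have hconst : ∀ a : ℝ, a = ∑ ω, p ω * a := fun a => by rw [← Finset.sum_mul, hp1, one_mul]
  set N : ℕ := ⌈R * (n : ℝ)⌉₊ with hN
  set Z : ℕ → Ω → (Fin m → Option M) := fun k => pre T k with hZ
  set Y : ℕ → Ω → S × (Fin m → Option M) := fun k ω => (X ω, Z k ω) with hY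
  set p0 : Fin n → Ω → ℝ := fun i => res p {ω | L i ω = false} with hp0
  set p1 : Fin n → Ω → ℝ := fun i => res p {ω | L i ω = true} with hp1'
  have hp0n : ∀ i ω, 0 ≤ p0 i ω := fun i => res_nonneg hp _
  have hp1n : ∀ i ω, 0 ≤ p1 i ω := fun i => res_nonneg hp _
  have hc0 : 0 < c := hb.trans_le hbc
  have hsplit : ∀ i k ω, mass (p1 i) (Y k) ω + mass (p0 i) (Y k) ω = mass p (Y k) ω :=
    fun i k ω => mass_split p (L i) (Y k) ω
  have hYeq : ∀ k ω ω', Y k ω = Y k ω' ↔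
      (X ω = X ω' ∧ ∀ i : Fin m, i.val < k → T i ω = T i ω') := by
    intro k ω ω'
    simp only [hY, hZ, Prod.mk.injEq, pre_eq]
  have hPpos : ∀ k ω, 0 < p ω → 0 < mass p (Y k) ω :=
    fun k ω h0 => h0.trans_le (le_mass hp _ _)
  have hY0 : ∀ ω, mass p (Y 0) ω = ((2:ℝ) ^ N)⁻¹ := by
    intro ω
    rw [← hXunif (X ω)]
    symm
    apply Pr_eq_mass'
    intro ω'
    simp [hYeq]
  have hprior' : ∀ i ω, mass (p0 i) (Y 0) ω = (1 - b) * mass p (Y 0) ω := by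
    intro i ω
    have h1 := hprior i (X ω) (by rw [hXunif]; positivity)
    unfold cPr at h1
    rw [Pr_eq_mass p {ω | L i ω = true} _ (Y 0) ω (by intro ω'; simp [hYeq, and_comm]),
      Pr_eq_mass' p _ (Y 0) ω (by intro ω'; simp [hYeq])] at h1
    have hpos : 0 < mass p (Y 0) ω := by rw [hY0]; positivity
    rw [div_eq_iff hpos.ne'] at h1
    have := hsplit i 0 ω
    simp only [hp1'] at this
    linarith
  have hpost' : ∀ i ω, 0 < p ω → mass (p1 i) (Y m) ω ≤ c * mass p (Y m) ω := by
    intro i ω h0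
    have e : Pr p {ω' | (∀ k, T k ω' = T k ω) ∧ X ω' = X ω} = mass p (Y m) ω :=
      Pr_eq_mass' p _ (Y m) ω (by intro ω'; simp [hYeq, and_comm])
    have h1 := hpost i (fun k => T k ω) (X ω) (by rw [e]; exact hPpos m ω h0)
    unfold cPr at h1
    rw [Pr_eq_mass p {ω | L i ω = true} _ (Y m) ω
      (by intro ω'; simp [hYeq]; tauto), e, div_le_iff₀ (hPpos m ω h0)] at h1
    exact h1
  have hrefY : ∀ k l, k ≤ l → ∀ ω ω', Y l ω = Y l ω' → Y k ω = Y k ω' := by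
    intro k l hkl ω ω' h
    rw [hYeq] at h ⊢
    exact ⟨h.1, fun i hi => h.2 i (by omega)⟩
  have hrefZ : ∀ k l, k ≤ l → ∀ ω ω', Z l ω = Z l ω' → Z k ω = Z k ω' := by
    intro k l hkl ω ω' h
    simp only [hZ, pre_eq] at h ⊢
    exact fun i hi => h i (by omega)
  have hrefYZ : ∀ k ω ω', Y k ω = Y k ω' → Z k ω = Z k ω' := by
    intro k ω ω' h
    exact (Prod.mk.injEq _ _ _ _ ▸ h).2
  have hP0m : ∀ i ω, 0 < p ω → (1 - c) * mass p (Y m) ω ≤ mass (p0 i) (Y m) ω := by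
    intro i ω h0
    have := hpost' i ω h0
    have := hsplit i m ω
    linarith
  have hP0pos : ∀ i k ω, k ≤ m → 0 < p ω → 0 < mass (p0 i) (Y k) ω := by
    intro i k ω hk h0
    have h1 := hP0m i ω h0
    have h2 : 0 < (1 - c) * mass p (Y m) ω := mul_pos (by linarith) (hPpos m ω h0)
    have h3 := mass_mono (hp0n i) (Y m) (Y k) (hrefY k m hk) ω
    linarith
  have hPT0pos : ∀ i k ω, k ≤ m → 0 < p ω → 0 < mass (p0 i) (Z k) ω := by
    intro i k ω hk h0
    exact (hP0pos i k ω hk h0).trans_le (mass_mono (hp0n i) (Y k) (Z k) (hrefYZ k) ω)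
  set F : Fin n → ℕ → ℝ := fun i k =>
    ∑ ω, p ω * (Real.log (mass p (Y k) ω) - Real.log (mass (p0 i) (Y k) ω)) with hF
  set I : ℕ → ℝ := fun k =>
    ∑ ω, p ω * (Real.log (mass p (Y k) ω) - Real.log (mass p (Z k) ω)) with hI
  have hFmono : ∀ i k, k < m → F i k ≤ F i (k+1) := by
    intro i k hk
    have := mono_info p (p0 i) hp (hp0n i) (Y (k+1)) (Y k) (hrefY k (k+1) (by omega))
      (fun ω h0 => hP0pos i (k+1) ω hk h0)
    simp only [hF]
    rw [← sub_nonneg, ← Finset.sum_sub_distrib] at this ⊢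
    refine this.trans (le_of_eq (Finset.sum_congr rfl fun ω _ => by ring))
  have hstep : ∀ k : Fin m, I (k+1) - I k ≤ F (j k) (k+1) - F (j k) k := by
    intro k
    have hk := k.2
    have := mono_info p (p0 (j k)) hp (hp0n (j k)) (Z (k+1)) (Z k) (hrefZ k (k+1) (by omega))
      (fun ω h0 => hPT0pos (j k) (k+1) ω hk h0)
    have heq : ∑ ω, p ω * (Real.log (mass (p0 (j k)) (Z (k+1)) ω) - Real.log (mass (p0 (j k)) (Z k) ω))
        = ∑ ω, p ω * (Real.log (mass (p0 (j k)) (Y (k+1)) ω) - Real.log (mass (p0 (j k)) (Y k) ω)) := by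
      refine Finset.sum_congr rfl fun ω _ => ?_
      rcases (hp ω).eq_or_lt with h0 | h0
      · simp [← h0]
      have a1 := hP0pos (j k) k ω hk.le h0
      have a2 := hP0pos (j k) (k+1) ω hk h0
      have a3 := hPT0pos (j k) k ω hk.le h0
      have a4 := hPT0pos (j k) (k+1) ω hk h0
      have e : Pr p {ω' | X ω' = X ω ∧ (∀ i, i < k → T i ω' = T i ω) ∧ L (j k) ω' = false}
          = mass (p0 (j k)) (Y k) ω :=
        Pr_eq_mass p _ _ (Y k) ω (by intro ω'; simp [hYeq, and_assoc])
      have e2 : Pr p {ω' | (∀ i, i < k → T i ω' = T i ω) ∧ L (j k) ω' = false}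
          = mass (p0 (j k)) (Z k) ω :=
        Pr_eq_mass p _ _ (Z k) ω (by intro ω'; simp [hZ, pre_eq])
      have hlast : ∀ ω', (∀ i : Fin m, i.val < k.val + 1 → T i ω' = T i ω) ↔
          (T k ω' = T k ω ∧ ∀ i, i < k → T i ω' = T i ω) := by
        intro ω'
        constructor
        · intro h
          exact ⟨h k (by omega), fun i hi => h i (by have : i.val < k.val := hi; omega)⟩
        · rintro ⟨h1, h2⟩ i hi
          rcases lt_or_eq_of_le (Nat.lt_succ_iff.mp hi) with h | h
          · exact h2 i h
          · rw [Fin.ext h]; exact h1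
      have h1 := hindep k (X ω) (T k ω) (fun i => T i ω) (by rw [e]; exact a1)
      unfold cPr at h1
      rw [e, e2, Pr_eq_mass p {ω | L (j k) ω = false} _ (Y (k+1)) ω
          (by intro ω'; simp only [hYeq, hlast, Set.mem_inter_iff, Set.mem_ofPred_eq]; tauto),
        Pr_eq_mass p {ω | L (j k) ω = false} _ (Z (k+1)) ω
          (by intro ω'; simp only [hZ, pre_eq, hlast, Set.mem_inter_iff, Set.mem_ofPred_eq]; tauto)] at h1
      rw [← Real.log_div a4.ne' a3.ne', ← Real.log_div a2.ne' a1.ne']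
      rw [show mass (p0 (j k)) (Y (k+1)) ω / mass (p0 (j k)) (Y k) ω =
        mass (p0 (j k)) (Z (k+1)) ω / mass (p0 (j k)) (Z k) ω from h1]
    rw [heq] at this
    simp only [hF, hI]
    rw [← sub_nonneg] at this ⊢
    simp only [← Finset.sum_sub_distrib] at this ⊢
    refine this.trans (le_of_eq (Finset.sum_congr rfl fun ω _ => by ring))
  have htel : ∀ k, k ≤ m → I k - I 0 ≤ ∑ i, (F i k - F i 0) := by
    intro k
    induction k with
    | zero => intro _; simp
    | succ k ih =>
      intro hk
      have h1 := ih (by omega)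
      have h2 := hstep ⟨k, hk⟩
      have h3 : F (j ⟨k, hk⟩) (k+1) - F (j ⟨k, hk⟩) k ≤ ∑ i, (F i (k+1) - F i k) :=
        Finset.single_le_sum (f := fun i => F i (k+1) - F i k)
          (fun i _ => sub_nonneg.mpr (hFmono i k hk)) (Finset.mem_univ _)
      have h4 : ∑ i, (F i (k+1) - F i 0) = ∑ i, (F i (k+1) - F i k) + ∑ i, (F i k - F i 0) := by
        rw [← Finset.sum_add_distrib]
        exact Finset.sum_congr rfl fun i _ => by ring
      simp only at h2
      linarith
  have hl2 : 0 < Real.log 2 := Real.log_pos (by norm_num)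
  have hF0 : ∀ i, F i 0 = -Real.log (1 - b) := by
    intro i
    simp only [hF]
    rw [hconst (-Real.log (1 - b))]
    refine Finset.sum_congr rfl fun ω _ => ?_
    have hpos : 0 < mass p (Y 0) ω := by rw [hY0]; positivity
    rw [hprior', Real.log_mul (by linarith) hpos.ne']
    ring
  have hI0 : I 0 = -(N * Real.log 2) := by
    simp only [hI]
    rw [hconst (-(N * Real.log 2))]
    refine Finset.sum_congr rfl fun ω _ => ?_
    have : mass p (Z 0) ω = 1 := by
      rw [← hp1]
      unfold mass
      refine Finset.sum_congr rfl fun ω' _ => ?_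
      rw [if_pos]
      simp [hZ, pre_eq]
    rw [this, hY0]
    simp
  have hp1sum : ∀ i, ∑ ω, p1 i ω = b := by
    intro i
    have h1 := mass_swap (p1 i) p (fun _ => (1:ℝ)) (hp1n i) hp (fun _ => zero_le_one) (Y 0) (fun _ _ _ => rfl)
    have h2 := mass_swap p (p1 i) (fun _ => (1:ℝ)) hp (hp1n i) (fun _ => zero_le_one) (Y 0) (fun _ _ _ => rfl)
    have hpos : ∀ ω, 0 < mass p (Y 0) ω := by intro ω; rw [hY0]; positivity
    have hb1 : ∀ ω, mass (p1 i) (Y 0) ω = b * mass p (Y 0) ω := by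
      intro ω
      have := hsplit i 0 ω
      have := hprior' i ω
      linarith
    have e1 : ∀ ω, mass p (Y 0) ω / mass (p1 i) (Y 0) ω = b⁻¹ := by
      intro ω; rw [hb1]; have := hpos ω; field_simp
    have e2 : ∀ ω, mass (p1 i) (Y 0) ω / mass p (Y 0) ω = b := by
      intro ω; rw [hb1]; have := hpos ω; field_simp
    simp only [e1, mul_one, ← Finset.sum_mul, hp1] at h1
    simp only [e2, mul_one, ← Finset.sum_mul, hp1] at h2
    rw [← div_eq_mul_inv, div_le_one hb] at h1
    linarith
  have hlc : Real.log (1 - c) < 0 := Real.log_neg (by linarith) (by linarith)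
  have hFm : ∀ i, F i m ≤ b * (-Real.log (1 - c) / c) := by
    intro i
    have hk0 : 0 ≤ -Real.log (1 - c) / c := div_nonneg (by linarith) hc0.le
    have h2 := mass_swap p (p1 i) (fun _ => (1:ℝ)) hp (hp1n i) (fun _ => zero_le_one) (Y m) (fun _ _ _ => rfl)
    simp only [mul_one, hp1sum] at h2
    refine le_trans ?_ (mul_le_mul_of_nonneg_right h2 hk0)
    rw [Finset.sum_mul]
    refine Finset.sum_le_sum fun ω _ => ?_
    rcases (hp ω).eq_or_lt with h0 | h0
    · simp [← h0]
    have a1 := hP0pos i m ω le_rfl h0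
    have a2 := hPpos m ω h0
    have a3 := hP0m i ω h0
    have a4 := hsplit i m ω
    have a5 := mass_nonneg (hp1n i) (Y m) ω
    rw [mul_assoc]
    refine mul_le_mul_of_nonneg_left ?_ h0.le
    have := neg_log_le c (mass (p0 i) (Y m) ω / mass p (Y m) ω) hc0 hc1
      (by rw [le_div_iff₀ a2]; exact a3) (by rw [div_le_one a2]; linarith)
    rw [Real.log_div a1.ne' a2.ne'] at this
    have e : mass (p1 i) (Y m) ω / mass p (Y m) ω = 1 - mass (p0 i) (Y m) ω / mass p (Y m) ω := by
      rw [← a4] at a2 ⊢; field_simp; ring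
    rw [e]
    linarith
  have hcardpos : (0:ℝ) < Fintype.card S := by rw [hcard]; positivity
  -- Fano
  have hIm : -Real.log 2 - Pr p {ω | D (fun k => T k ω) ≠ X ω} * (N * Real.log 2) ≤ I m := by
    obtain ⟨ω₁⟩ : Nonempty Ω := by
      by_contra h
      rw [not_nonempty_iff] at h
      simp at hp1
    have hM : ∀ k : Fin m, Nonempty M := fun k => ⟨T k ω₁⟩
    set D' : (Fin m → Option M) → S := fun z => D (fun k => (z k).getD (T k ω₁)) with hD'
    have hDD : ∀ ω, D' (Z m ω) = D (fun k => T k ω) := by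
      intro ω
      simp [hD', hZ, pre]
    have := fano p hp X (Z m) (fun ω => if X ω = D' (Z m ω) then 1/2 else 1/2 * (Fintype.card S : ℝ)⁻¹)
      (fun x z => if x = D' z then 1/2 else 1/2 * (Fintype.card S : ℝ)⁻¹) (fun _ => rfl)
      (fun x z => by split_ifs <;> positivity)
      (fun z => by
        calc ∑ x, (if x = D' z then 1/2 else 1/2 * (Fintype.card S : ℝ)⁻¹)
            ≤ ∑ x, ((if x = D' z then (1/2 : ℝ) else 0) + 1/2 * (Fintype.card S : ℝ)⁻¹) := by
              refine Finset.sum_le_sum fun x _ => ?_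
              split_ifs
              · have : (0:ℝ) ≤ 1/2 * (Fintype.card S : ℝ)⁻¹ := by positivity
                linarith
              · simp
          _ = 1 := by
              rw [Finset.sum_add_distrib]
              simp
              field_simp
              norm_num)
    refine le_trans (le_of_eq ?_) this
    unfold Pr
    rw [Finset.sum_mul, hconst (-Real.log 2), ← Finset.sum_sub_distrib]
    refine Finset.sum_congr rfl fun ω _ => ?_
    simp only [hDD]
    by_cases h : X ω = D (fun k => T k ω)
    · simp [h]
    · rw [if_neg h, Set.indicator_of_mem (by simpa using Ne.symm h), hcard,
        Real.log_mul (by norm_num) (by positivity)]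
      simp
      ring
  have hmain := htel m le_rfl
  have hsum : ∑ i, (F i m - F i 0) ≤ n * (κ * Real.log 2) := by
    calc ∑ i, (F i m - F i 0) ≤ ∑ i : Fin n, κ * Real.log 2 := by
          refine Finset.sum_le_sum fun i _ => ?_
          have h1 := hFm i
          have h2 := hF0 i
          have e : κ * Real.log 2 = b * (-Real.log (1 - c) / c) + Real.log (1 - b) := by
            rw [hκ]; unfold Real.logb; field_simp
          linarith
      _ = _ := by simp
  have hRN : R * n ≤ N := Nat.le_ceil _
  have hPr0 : 0 ≤ Pr p {ω | D (fun k => T k ω) ≠ X ω} :=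
    Finset.sum_nonneg fun ω _ => Set.indicator_nonneg (fun _ _ => hp _) _
  rcases Nat.eq_zero_or_pos N with h0 | h0
  · simp only [h0, Nat.cast_zero, div_zero]; exact hPr0
  · rw [div_le_iff₀ (by exact_mod_cast h0)]
    have key : (N - 1 - Pr p {ω | D (fun k => T k ω) ≠ X ω} * N) * Real.log 2 ≤ (n * κ) * Real.log 2 := by
      linarith
    have key2 := le_of_mul_le_mul_right key hl2
    rw [hδ]
    linarith
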